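/- Let (u, θ) be a smooth solution of the thermoelastic system and suppose u(t,·) = γ(t,·) + χ(t,·) for smooth functions γ, χ : [0,∞)×Ω̄ → ℝ^d, where div γ = 0 in Ω and γ·n = 0 on ∂Ω for every t, and χ(t,·) = ∇φ(t,·) for a smooth function φ (the Helmholtz decomposition of u). Then: (i) γ solves the homogeneous wave system γ_tt − μΔγ = 0 in (0,∞)×Ω with γ·n = 0 and 𝒩γ = 0 on (0,∞)×∂Ω; (ii) (χ, θ) solves χ_tt − (2μ+λ)Δχ = −ν∇θ and θ_t − Δθ = −ν θ div(χ_t) in (0,∞)×Ω with χ·n = 0 and ∇θ·n = 0 on (0,∞)×∂Ω; (iii) the energies decompose: (1/2)∫_Ω |γ_t(t)|² dx + (μ/2)∫_Ω |curl γ(t)|² dx is constant in t, and (1/2)∫_Ω |χ_t(t)|² dx + ((2μ+λ)/2)∫_Ω (div χ(t))² dx + ∫_Ω θ(t) dx is constant in t. -/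

import Mathlib

open MeasureTheory Real Filter Set
open scoped Topology

noncomputable section

/-- Euclidean space `ℝ^d`. -/
abbrev Ed (d : ℕ) := EuclideanSpace ℝ (Fin d)

/-- Partial derivative of a scalar function in the `i`-th coordinate direction. -/
def pd {d : ℕ} (i : Fin d) (f : Ed d → ℝ) (x : Ed d) : ℝ :=
  fderiv ℝ f x (EuclideanSpace.single i 1)

/-- Divergence of a vector field. -/
def divg {d : ℕ} (w : Ed d → Ed d) (x : Ed d) : ℝ :=
  ∑ i, pd i (fun y => w y i) x

/-- Laplacian of a scalar function. -/
def lap {d : ℕ} (f : Ed d → ℝ) (x : Ed d) : ℝ :=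
  ∑ i, pd i (fun y => pd i f y) x

/-- Squared euclidean norm of the gradient of a scalar function. -/
def gradNormSq {d : ℕ} (f : Ed d → ℝ) (x : Ed d) : ℝ :=
  ∑ i, (pd i f x) ^ 2

/-- Squared Frobenius norm of the Hessian of a scalar function. -/
def hessNormSq {d : ℕ} (f : Ed d → ℝ) (x : Ed d) : ℝ :=
  ∑ i, ∑ j, (pd i (fun y => pd j f y) x) ^ 2

/-- The antisymmetric curl two-form `(curl w)ᵢⱼ = ∂ᵢ wⱼ - ∂ⱼ wᵢ`. -/
def curlM {d : ℕ} (w : Ed d → Ed d) (x : Ed d) (i j : Fin d) : ℝ :=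
  pd i (fun y => w y j) x - pd j (fun y => w y i) x

/-- `|curl w|²`: in dimension 2 (scalar curl) and 3 (vector curl) this equals
the squared norm of the curl. -/
def curlNormSq {d : ℕ} (w : Ed d → Ed d) (x : Ed d) : ℝ :=
  (1 / 2) * ∑ i, ∑ j, (curlM w x i j) ^ 2

/-- `j`-th component of `curl curl w` (in dimensions 2 and 3 this is
`∑ i ∂ᵢ (∂ⱼ wᵢ - ∂ᵢ wⱼ) = ∂ⱼ (div w) - Δ wⱼ`). -/
def ccurl {d : ℕ} (w : Ed d → Ed d) (x : Ed d) (j : Fin d) : ℝ :=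
  ∑ i, pd i (fun y => curlM w y j i) x

/-- `j`-th component of the componentwise Laplacian of a vector field. -/
def veclap {d : ℕ} (w : Ed d → Ed d) (x : Ed d) (j : Fin d) : ℝ :=
  ∑ i, pd i (fun y => pd i (fun z => w z j) y) x

/-- Time derivative of a time-dependent field. -/
def tder {α : Type*} {F : Type*} [NormedAddCommGroup F] [NormedSpace ℝ F]
    (u : ℝ → α → F) : ℝ → α → F :=
  fun t x => deriv (fun s => u s x) t

/-- An open, bounded, convex domain in `ℝ^d` (`d ∈ {2,3}`) together with its outward
unit normal field `n` on the boundary.  For a convex body with smooth boundary the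
outward unit normal at a boundary point is characterized by the supporting
half-space inequality. -/
structure GoodDomain (d : ℕ) (Ω : Set (Ed d)) (n : Ed d → Ed d) : Prop where
  dims : d = 2 ∨ d = 3
  isOpen : IsOpen Ω
  bounded : Bornology.IsBounded Ω
  convex : Convex ℝ Ω
  nonempty : Ω.Nonempty
  normal_unit : ∀ x ∈ frontier Ω, ‖n x‖ = 1
  normal_outward : ∀ x ∈ frontier Ω, ∀ y ∈ closure Ω, ∑ i, (y i - x i) * n x i ≤ 0

/-- A smooth solution `(u, θ)` of the thermoelastic system
`u_tt - (2μ+λ)∇(div u) + μ curl curl u = -ν∇θ`, `θ_t - Δθ = -ν θ div u_t`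
with boundary conditions `u·n = 0`, `𝒩u = 0` (encoded as `(curl u) n = 0`,
which in dimension 2 means `curl u = 0` and in dimension 3 means
`curl u × n = 0`) and `∇θ·n = 0`, and with positive temperature. -/
structure IsSolution {d : ℕ} (Ω : Set (Ed d)) (n : Ed d → Ed d)
    (μ lam ν : ℝ) (u : ℝ → Ed d → Ed d) (θ : ℝ → Ed d → ℝ) : Prop where
  smooth_u : ContDiff ℝ (⊤ : ℕ∞) (fun p : ℝ × Ed d => u p.1 p.2)
  smooth_θ : ContDiff ℝ (⊤ : ℕ∞) (fun p : ℝ × Ed d => θ p.1 p.2)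
  theta_pos : ∀ t : ℝ, 0 ≤ t → ∀ x ∈ closure Ω, 0 < θ t x
  wave : ∀ t : ℝ, 0 < t → ∀ x ∈ Ω, ∀ j : Fin d,
    tder (tder u) t x j - (2 * μ + lam) * pd j (divg (u t)) x
      + μ * ccurl (u t) x j = -ν * pd j (θ t) x
  heat : ∀ t : ℝ, 0 < t → ∀ x ∈ Ω,
    tder θ t x - lap (θ t) x = -ν * θ t x * divg (tder u t) x
  bc_u : ∀ t : ℝ, 0 < t → ∀ x ∈ frontier Ω, ∑ i, u t x i * n x i = 0
  bc_N : ∀ t : ℝ, 0 < t → ∀ x ∈ frontier Ω, ∀ i : Fin d,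
    ∑ j, curlM (u t) x i j * n x j = 0
  bc_θ : ∀ t : ℝ, 0 < t → ∀ x ∈ frontier Ω, ∑ i, pd i (θ t) x * n x i = 0

/-- The functional `F(u, u_t, θ)` built from the Fisher information and
higher-order derivatives of the displacement. -/
def Ffun {d : ℕ} (Ω : Set (Ed d)) (μ lam : ℝ)
    (u : ℝ → Ed d → Ed d) (θ : ℝ → Ed d → ℝ) (t : ℝ) : ℝ :=
  (1 / 2) * ((∫ x in Ω, (divg (tder u t) x) ^ 2)
    + (∫ x in Ω, curlNormSq (tder u t) x)
    + (2 * μ + lam) * (∫ x in Ω, gradNormSq (divg (u t)) x)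
    + μ * (∫ x in Ω, ∑ j, (ccurl (u t) x j) ^ 2)
    + (∫ x in Ω, gradNormSq (θ t) x / θ t x))

/-- The small-data condition
`‖div v₀‖² + ‖curl v₀‖² + (2μ+λ)‖∇div u₀‖² + μ‖curl curl u₀‖² + ‖∇θ₀/√θ₀‖² ≤ D`. -/
def smallData {d : ℕ} (Ω : Set (Ed d)) (μ lam : ℝ)
    (u0 v0 : Ed d → Ed d) (θ0 : Ed d → ℝ) (D : ℝ) : Prop :=
  (∫ x in Ω, (divg v0 x) ^ 2) + (∫ x in Ω, curlNormSq v0 x)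
    + (2 * μ + lam) * (∫ x in Ω, gradNormSq (divg u0) x)
    + μ * (∫ x in Ω, ∑ j, (ccurl u0 x j) ^ 2)
    + (∫ x in Ω, gradNormSq θ0 x / θ0 x) ≤ D

/-- The norm `‖w‖_H = (‖div w‖² + ‖curl w‖²)^{1/2}`. -/
def Hnorm {d : ℕ} (Ω : Set (Ed d)) (w : Ed d → Ed d) : ℝ :=
  Real.sqrt ((∫ x in Ω, (divg w x) ^ 2) + (∫ x in Ω, curlNormSq w x))

end

/-- At an interior point `x` whose nearest point of the complement is `y`, the unit normal at `y`
points from `x` to `y`. -/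
lemma GoodDomain.sub_eq_smul_normal {d : ℕ} {Ω : Set (Ed d)} {n : Ed d → Ed d}
    (hdom : GoodDomain d Ω n) {x y : Ed d} (hxy : dist x y = Metric.infDist x Ωᶜ)
    (hy : y ∈ frontier Ω) : y - x = Metric.infDist x Ωᶜ • n y := by
  set δ := Metric.infDist x Ωᶜ with hδ
  have hn := hdom.normal_unit y hy
  have hδ0 : 0 ≤ δ := Metric.infDist_nonneg
  have hball : Metric.ball x δ ⊆ Ω := Metric.ball_infDist_compl_subset
  have hz : x + δ • n y ∈ closure Ω := by
    rcases hδ0.eq_or_lt with h0 | hpos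
    · have : x = y := dist_eq_zero.1 (hxy.trans h0.symm)
      rw [← h0, zero_smul, add_zero, this]
      exact frontier_subset_closure hy
    · refine closure_mono hball ?_
      rw [closure_ball x hpos.ne', Metric.mem_closedBall, dist_eq_norm]
      simp [norm_smul, hn, abs_of_nonneg hδ0]
  have h1 := hdom.normal_outward y hy _ hz
  have h2 : ∑ i, ((x + δ • n y) i - y i) * n y i = inner ℝ (x + δ • n y - y) (n y) := by
    simp [PiLp.inner_apply, mul_comm]
  have h3 : inner ℝ (x + δ • n y - y) (n y) = δ - inner ℝ (y - x) (n y) := by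
    have : x + δ • n y - y = δ • n y - (y - x) := by abel
    rw [this, inner_sub_left, inner_smul_left, real_inner_self_eq_norm_sq, hn]
    simp
  have h4 : ‖y - x‖ = δ := by rw [← dist_eq_norm, dist_comm, hxy]
  have h5 : ‖y - x - δ • n y‖ ^ 2 ≤ 0 := by
    rw [norm_sub_sq_real, h4, norm_smul, hn, inner_smul_right, Real.norm_eq_abs,
      abs_of_nonneg hδ0]
    nlinarith
  have h6 : ‖y - x - δ • n y‖ = 0 := by nlinarith [norm_nonneg (y - x - δ • n y)]
  exact sub_eq_zero.1 (norm_eq_zero.1 h6)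

/-- A linear form of norm at most one that takes a value at most `-1` at a unit vector `e` is the
inner product with `-e`. -/
lemma apply_eq_neg_inner_of_le {E : Type*} [NormedAddCommGroup E] [InnerProductSpace ℝ E]
    [CompleteSpace E] {L : E →L[ℝ] ℝ} (hL : ‖L‖ ≤ 1) {e : E} (he : ‖e‖ = 1) (hLe : L e ≤ -1)
    (v : E) : L v = -inner ℝ e v := by
  set G := (InnerProductSpace.toDual ℝ E).symm L
  have hG : ∀ w, inner ℝ G w = L w := fun w => InnerProductSpace.toDual_symm_apply
  have hGn : ‖G‖ ≤ 1 := by simpa [G] using hL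
  have h : ‖G + e‖ ^ 2 ≤ 0 := by
    rw [norm_add_sq_real, hG, he]
    nlinarith [norm_nonneg G]
  have h0 : G + e = 0 := by
    rw [← norm_eq_zero]; nlinarith [norm_nonneg (G + e)]
  rw [← hG, eq_neg_of_add_eq_zero_left h0, inner_neg_left]

/-- Every point of a good domain has a nearest point in the complement, and that point lies on
the boundary. -/
lemma GoodDomain.exists_nearest {d : ℕ} {Ω : Set (Ed d)} {n : Ed d → Ed d}
    (hdom : GoodDomain d Ω n) {x : Ed d} (hx : x ∈ Ω) :
    0 < Metric.infDist x Ωᶜ ∧ ∃ y ∈ frontier Ω, dist x y = Metric.infDist x Ωᶜ := by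
  have hcl : IsClosed Ωᶜ := hdom.isOpen.isClosed_compl
  have hne : (Ωᶜ).Nonempty := by
    by_contra h
    have hu : Ω = univ := by
      rwa [Set.not_nonempty_iff_eq_empty, Set.compl_empty_iff] at h
    have hb := hdom.bounded
    rw [hu] at hb
    have : Nontrivial (Ed d) := by
      have : Nonempty (Fin d) := by
        rcases hdom.dims with h | h <;> subst h <;> exact ⟨0⟩
      exact inferInstance
    exact NormedSpace.unbounded_univ ℝ (Ed d) hb
  have hpos : 0 < Metric.infDist x Ωᶜ :=
    (hcl.notMem_iff_infDist_pos hne).1 (fun h => h hx)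
  obtain ⟨y, hy, hxy⟩ := hcl.exists_infDist_eq_dist hne x
  refine ⟨hpos, y, ?_, hxy.symm⟩
  rw [hdom.isOpen.frontier_eq]
  refine ⟨?_, hy⟩
  refine closure_mono (Metric.ball_infDist_compl_subset (x := x)) ?_
  rw [closure_ball x hpos.ne', Metric.mem_closedBall, dist_comm]
  exact hxy.ge

/-- Where the distance to the complement is differentiable, its derivative is minus the inner
product with the normal at a nearest boundary point. -/
lemma GoodDomain.fderiv_infDist {d : ℕ} {Ω : Set (Ed d)} {n : Ed d → Ed d}
    (hdom : GoodDomain d Ω n) {x y : Ed d} (hpos : 0 < Metric.infDist x Ωᶜ)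
    (hxy : dist x y = Metric.infDist x Ωᶜ) (hy : y ∈ frontier Ω)
    (hdiff : DifferentiableAt ℝ (fun z => Metric.infDist z Ωᶜ) x) (v : Ed d) :
    fderiv ℝ (fun z => Metric.infDist z Ωᶜ) x v = -inner ℝ (n y) v := by
  refine apply_eq_neg_inner_of_le ?_ (hdom.normal_unit y hy) ?_ v
  · simpa using norm_fderiv_le_of_lipschitz ℝ
      (Metric.lipschitz_infDist_pt (Ωᶜ)) (x₀ := x)
  · set δ := Metric.infDist x Ωᶜ with hδ
    have hn := hdom.normal_unit y hy
    have hyx := hdom.sub_eq_smul_normal hxy hy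
    have hyc : y ∈ Ωᶜ := by
      rw [hdom.isOpen.frontier_eq] at hy
      exact hy.2
    have hder := (hdiff.hasFDerivAt.hasLineDerivAt (n y)).tendsto_slope_zero_right
    refine le_of_tendsto hder ?_
    filter_upwards [Ioo_mem_nhdsGT hpos] with s hs
    have h1 : Metric.infDist (x + s • n y) Ωᶜ ≤ δ - s := by
      refine (Metric.infDist_le_dist_of_mem hyc).trans ?_
      have : x + s • n y - y = -((δ - s) • n y) := by
        rw [sub_smul, ← hyx]; abel
      rw [dist_eq_norm, this, norm_neg, norm_smul, hn, mul_one, Real.norm_eq_abs,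
        abs_of_nonneg (by linarith [hs.2])]
    rw [smul_eq_mul, inv_mul_le_iff₀ hs.1]
    linarith

/-- The cutoff `min 1 (k δ)`, with `δ` the distance to the complement of `Ω`. -/
noncomputable def cutoff {d : ℕ} (Ω : Set (Ed d)) (k : ℕ) (x : Ed d) : ℝ :=
  min 1 (k * Metric.infDist x Ωᶜ)

lemma cutoff_nonneg {d : ℕ} (Ω : Set (Ed d)) (k : ℕ) (x : Ed d) : 0 ≤ cutoff Ω k x :=
  le_min zero_le_one (mul_nonneg k.cast_nonneg Metric.infDist_nonneg)

lemma cutoff_le_one {d : ℕ} (Ω : Set (Ed d)) (k : ℕ) (x : Ed d) : cutoff Ω k x ≤ 1 :=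
  min_le_left _ _

lemma cutoff_of_notMem {d : ℕ} {Ω : Set (Ed d)} {k : ℕ} {x : Ed d} (hx : x ∉ Ω) :
    cutoff Ω k x = 0 := by
  simp [cutoff, Metric.infDist_zero_of_mem (show x ∈ Ωᶜ from hx)]

lemma lipschitzWith_cutoff {d : ℕ} (Ω : Set (Ed d)) (k : ℕ) :
    LipschitzWith k (cutoff Ω k) := by
  refine LipschitzWith.const_min (LipschitzWith.of_dist_le_mul fun x y => ?_) 1
  have h := (Metric.lipschitz_infDist_pt (Ωᶜ)).dist_le_mul x y
  rw [Real.dist_eq] at h ⊢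
  rw [← mul_sub, abs_mul, Nat.abs_cast]
  simpa using mul_le_mul_of_nonneg_left h (Nat.cast_nonneg (α := ℝ) k)

lemma hasCompactSupport_cutoff {d : ℕ} {Ω : Set (Ed d)} (hΩ : Bornology.IsBounded Ω) (k : ℕ) :
    HasCompactSupport (cutoff Ω k) :=
  HasCompactSupport.intro hΩ.isCompact_closure fun _ hx =>
    cutoff_of_notMem fun h => hx (subset_closure h)

/-- The derivative of the cutoff along a tangential Lipschitz field is bounded independently
of the cutoff parameter, and supported in a thin boundary layer. -/
lemma GoodDomain.abs_sum_fderiv_cutoff_le {d : ℕ} {Ω : Set (Ed d)} {n : Ed d → Ed d}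
    (hdom : GoodDomain d Ω n) {W : Fin d → Ed d → ℝ} {K : Fin d → NNReal}
    (hW : ∀ i, LipschitzWith (K i) (W i)) (hb : ∀ x ∈ frontier Ω, ∑ i, W i x * n x i = 0)
    (k : ℕ) {x : Ed d}
    (hδ : DifferentiableAt ℝ (fun z => Metric.infDist z Ωᶜ) x) :
    |∑ i, fderiv ℝ (cutoff Ω k) x (EuclideanSpace.single i 1) * W i x|
      ≤ {y ∈ Ω | k * Metric.infDist y Ωᶜ < 1}.indicator (fun _ => ∑ i, (K i : ℝ)) x := by
  by_cases hx : x ∈ {y ∈ Ω | k * Metric.infDist y Ωᶜ < 1}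
  · rw [indicator_of_mem hx]
    obtain ⟨hxΩ, hxk⟩ := hx
    obtain ⟨hpos, y, hy, hxy⟩ := hdom.exists_nearest hxΩ
    have hloc : cutoff Ω k =ᶠ[𝓝 x] fun z => (k : ℝ) * Metric.infDist z Ωᶜ := by
      have hc : Continuous fun z : Ed d => (k : ℝ) * Metric.infDist z Ωᶜ :=
        continuous_const.mul (Metric.continuous_infDist_pt _)
      filter_upwards [hc.continuousAt.eventually_lt continuousAt_const hxk] with z hz
      exact min_eq_right hz.le
    have hf : ∀ i, fderiv ℝ (cutoff Ω k) x (EuclideanSpace.single i 1) = -(k * n y i) := by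
      intro i
      rw [hloc.fderiv_eq, fderiv_const_mul hδ]
      simp [hdom.fderiv_infDist hpos hxy hy hδ, EuclideanSpace.inner_single_right]
    have hsum : ∑ i, fderiv ℝ (cutoff Ω k) x (EuclideanSpace.single i 1) * W i x
        = ∑ i, k * (n y i * (W i y - W i x)) := by
      have h0 : ∑ i, (k : ℝ) * (W i y * n y i) = 0 := by
        rw [← Finset.mul_sum, hb y hy, mul_zero]
      rw [← sub_zero (∑ i, fderiv ℝ (cutoff Ω k) x (EuclideanSpace.single i 1) * W i x),
        ← neg_zero, ← h0, sub_neg_eq_add, ← Finset.sum_add_distrib]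
      refine Finset.sum_congr rfl fun i _ => ?_
      rw [hf]; ring
    rw [hsum]
    refine (Finset.abs_sum_le_sum_abs _ _).trans (Finset.sum_le_sum fun i _ => ?_)
    have h1 : |n y i| ≤ 1 := by
      rw [← hdom.normal_unit y hy, ← Real.norm_eq_abs]
      exact PiLp.norm_apply_le _ i
    have h2 : |W i y - W i x| ≤ K i * Metric.infDist x Ωᶜ := by
      rw [← hxy, dist_comm x y, ← Real.dist_eq]
      exact (hW i).dist_le_mul y x
    rw [abs_mul, abs_mul, Nat.abs_cast]
    have h3 : |n y i| * |W i y - W i x| ≤ 1 * (K i * Metric.infDist x Ωᶜ) :=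
      mul_le_mul h1 h2 (abs_nonneg _) zero_le_one
    calc (k : ℝ) * (|n y i| * |W i y - W i x|)
        ≤ k * (1 * (K i * Metric.infDist x Ωᶜ)) :=
          mul_le_mul_of_nonneg_left h3 k.cast_nonneg
      _ = K i * (k * Metric.infDist x Ωᶜ) := by ring
      _ ≤ K i * 1 := mul_le_mul_of_nonneg_left hxk.le (K i).2
      _ = K i := mul_one _
  · rw [indicator_of_notMem hx]
    have hf : fderiv ℝ (cutoff Ω k) x = 0 := by
      by_cases hxΩ : x ∈ Ω
      · have hxk : 1 ≤ k * Metric.infDist x Ωᶜ := not_lt.1 fun h => hx ⟨hxΩ, h⟩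
        have : cutoff Ω k x = 1 := min_eq_left hxk
        exact IsLocalMax.fderiv_eq_zero (Eventually.of_forall fun z => by
          rw [this]; exact cutoff_le_one Ω k z)
      · exact IsLocalMin.fderiv_eq_zero (Eventually.of_forall fun z => by
          rw [cutoff_of_notMem hxΩ]; exact cutoff_nonneg Ω k z)
    simp [hf]

lemma IsOpen.measurableSet_layer {d : ℕ} {Ω : Set (Ed d)} (hΩ : IsOpen Ω) (k : ℕ) :
    MeasurableSet {y ∈ Ω | k * Metric.infDist y Ωᶜ < 1} :=
  hΩ.measurableSet.inter
    (measurableSet_lt (measurable_const.mul measurable_infDist) measurable_const)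

/-- Integration by parts against the cutoff. -/
lemma GoodDomain.abs_integral_cutoff_mul_le {d : ℕ} {Ω : Set (Ed d)} {n : Ed d → Ed d}
    (hdom : GoodDomain d Ω n) {W : Fin d → Ed d → ℝ} {K : Fin d → NNReal}
    (hW : ∀ i, LipschitzWith (K i) (W i)) (hWd : ∀ i, Differentiable ℝ (W i))
    (hWc : ∀ i, HasCompactSupport (W i))
    (hb : ∀ x ∈ frontier Ω, ∑ i, W i x * n x i = 0) (k : ℕ) :
    |∫ x, (∑ i, pd i (W i) x) * cutoff Ω k x|
      ≤ volume.real {y ∈ Ω | k * Metric.infDist y Ωᶜ < 1} * ∑ i, (K i : ℝ) := by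
  have hηl := lipschitzWith_cutoff Ω k
  have hηc := hasCompactSupport_cutoff hdom.bounded k
  have hmeas := hdom.isOpen.measurableSet_layer k
  have hfin : volume {y ∈ Ω | k * Metric.infDist y Ωᶜ < 1} ≠ ⊤ :=
    ((hdom.bounded.subset (sep_subset _ _)).measure_lt_top).ne
  have hpd : ∀ i x, pd i (W i) x = lineDeriv ℝ (W i) x (EuclideanSpace.single i 1) := fun i x =>
    ((hWd i x).lineDeriv_eq_fderiv).symm
  have hint1 : ∀ i, Integrable (fun x => pd i (W i) x * cutoff Ω k x) := by
    intro i
    simp_rw [hpd]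
    exact ((hW i).locallyIntegrable_lineDeriv _).integrable_smul_right_of_hasCompactSupport
      hηl.continuous hηc
  have hint2 : ∀ i, Integrable
      (fun x => lineDeriv ℝ (cutoff Ω k) x (-EuclideanSpace.single i 1) * W i x) := by
    intro i
    exact (hηl.locallyIntegrable_lineDeriv _).integrable_smul_right_of_hasCompactSupport
      (hW i).continuous (hWc i)
  have h1 : ∫ x, (∑ i, pd i (W i) x) * cutoff Ω k x
      = ∫ x, ∑ i, lineDeriv ℝ (cutoff Ω k) x (-EuclideanSpace.single i 1) * W i x := by
    simp_rw [Finset.sum_mul]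
    rw [integral_finsetSum _ fun i _ => hint1 i, integral_finsetSum _ fun i _ => hint2 i]
    refine Finset.sum_congr rfl fun i _ => ?_
    simp_rw [hpd]
    exact (hW i).integral_lineDeriv_mul_eq hηl hηc _
  rw [h1, ← Real.norm_eq_abs]
  have h2 := norm_integral_le_of_norm_le (μ := volume)
    (f := fun x => ∑ i, lineDeriv ℝ (cutoff Ω k) x (-EuclideanSpace.single i 1) * W i x)
    (g := {y ∈ Ω | k * Metric.infDist y Ωᶜ < 1}.indicator (fun _ => ∑ i, (K i : ℝ)))
    ((integrable_indicator_iff hmeas).2 (integrableOn_const hfin)) (by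
      filter_upwards [hηl.ae_differentiableAt (μ := volume),
        (Metric.lipschitz_infDist_pt (Ωᶜ)).ae_differentiableAt (μ := volume)] with x hx1 hx2
      have h3 := hdom.abs_sum_fderiv_cutoff_le hW hb k hx2
      simp_rw [hx1.lineDeriv_eq_fderiv, map_neg, neg_mul, Finset.sum_neg_distrib, norm_neg,
        Real.norm_eq_abs]
      exact h3)
  refine h2.trans (le_of_eq ?_)
  rw [integral_indicator hmeas, setIntegral_const, smul_eq_mul]

/-- The boundary layers shrink to a null set. -/
lemma GoodDomain.tendsto_volume_layer {d : ℕ} {Ω : Set (Ed d)} {n : Ed d → Ed d}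
    (hdom : GoodDomain d Ω n) :
    Tendsto (fun k : ℕ => volume.real {y ∈ Ω | k * Metric.infDist y Ωᶜ < 1}) atTop (𝓝 0) := by
  have hanti : Antitone fun k : ℕ => {y ∈ Ω | k * Metric.infDist y Ωᶜ < 1} := by
    intro k l hkl y hy
    refine ⟨hy.1, lt_of_le_of_lt ?_ hy.2⟩
    exact mul_le_mul_of_nonneg_right (by exact_mod_cast hkl) Metric.infDist_nonneg
  have hempty : ⋂ k : ℕ, {y ∈ Ω | k * Metric.infDist y Ωᶜ < 1} = ∅ := by
    refine eq_empty_of_forall_notMem fun y hy => ?_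
    rw [mem_iInter] at hy
    have hpos := (hdom.exists_nearest (hy 0).1).1
    obtain ⟨k, hk⟩ := exists_nat_gt (Metric.infDist y Ωᶜ)⁻¹
    have := (hy k).2
    rw [inv_lt_iff_one_lt_mul₀ hpos] at hk
    linarith
  have h := tendsto_measure_iInter_atTop (μ := (volume : Measure (Ed d)))
    (s := fun k : ℕ => {y ∈ Ω | k * Metric.infDist y Ωᶜ < 1})
    (fun k => (hdom.isOpen.measurableSet_layer k).nullMeasurableSet) hanti
    ⟨0, ((hdom.bounded.subset (sep_subset _ _)).measure_lt_top).ne⟩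
  rw [hempty, measure_empty] at h
  exact (ENNReal.tendsto_toReal ENNReal.zero_ne_top).comp h

lemma GoodDomain.setIntegral_div_eq_zero_of_hasCompactSupport {d : ℕ} {Ω : Set (Ed d)}
    {n : Ed d → Ed d} (hdom : GoodDomain d Ω n) {W : Fin d → Ed d → ℝ}
    (hW : ∀ i, ContDiff ℝ 1 (W i)) (hWc : ∀ i, HasCompactSupport (W i))
    (hb : ∀ x ∈ frontier Ω, ∑ i, W i x * n x i = 0) :
    ∫ x in Ω, ∑ i, pd i (W i) x = 0 := by
  choose K hK using fun i => (hW i).lipschitzWith_of_hasCompactSupport (hWc i) one_ne_zero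
  have hpdc : Continuous fun x => ∑ i, pd i (W i) x :=
    continuous_finsetSum _ fun i _ =>
      ((hW i).continuous_fderiv one_ne_zero).clm_apply continuous_const
  have h1 : Tendsto (fun k : ℕ => ∫ x, (∑ i, pd i (W i) x) * cutoff Ω k x) atTop (𝓝 0) := by
    refine squeeze_zero_norm (fun k => ?_) (by
      simpa using hdom.tendsto_volume_layer.mul_const (∑ i, (K i : ℝ)))
    exact hdom.abs_integral_cutoff_mul_le hK (fun i => (hW i).differentiable one_ne_zero) hWc hb k
  have h2 : Tendsto (fun k : ℕ => ∫ x, (∑ i, pd i (W i) x) * cutoff Ω k x) atTop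
      (𝓝 (∫ x, Ω.indicator (fun x => ∑ i, pd i (W i) x) x)) := by
    refine tendsto_integral_of_dominated_convergence
      (Ω.indicator fun x => |∑ i, pd i (W i) x|) (fun k => ?_) ?_ (fun k => ?_) ?_
    · exact (hpdc.mul (lipschitzWith_cutoff Ω k).continuous).aestronglyMeasurable
    · rw [integrable_indicator_iff hdom.isOpen.measurableSet]
      exact (hpdc.abs.continuousOn.integrableOn_compact
        hdom.bounded.isCompact_closure).mono_set subset_closure
    · refine Eventually.of_forall fun x => ?_
      by_cases hx : x ∈ Ω
      · rw [indicator_of_mem hx, norm_mul, Real.norm_eq_abs, Real.norm_eq_abs,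
          abs_of_nonneg (cutoff_nonneg Ω k x)]
        exact mul_le_of_le_one_right (abs_nonneg _) (cutoff_le_one Ω k x)
      · simp [cutoff_of_notMem hx, hx]
    · refine Eventually.of_forall fun x => ?_
      by_cases hx : x ∈ Ω
      · rw [indicator_of_mem hx]
        refine tendsto_const_nhds.congr' ?_
        have hpos := (hdom.exists_nearest hx).1
        obtain ⟨N, hN⟩ := exists_nat_gt (Metric.infDist x Ωᶜ)⁻¹
        filter_upwards [eventually_ge_atTop N] with k hk
        rw [inv_lt_iff_one_lt_mul₀ hpos] at hN
        have : (1 : ℝ) ≤ k * Metric.infDist x Ωᶜ := hN.le.trans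
          (mul_le_mul_of_nonneg_right (by exact_mod_cast hk) hpos.le)
        simp [cutoff, min_eq_left this]
      · simp [cutoff_of_notMem hx, hx]
  rw [← integral_indicator hdom.isOpen.measurableSet]
  exact tendsto_nhds_unique h2 h1

/-- The divergence theorem for fields tangential to the boundary of a good domain. -/
theorem GoodDomain.setIntegral_div_eq_zero {d : ℕ} {Ω : Set (Ed d)}
    {n : Ed d → Ed d} (hdom : GoodDomain d Ω n) {W : Fin d → Ed d → ℝ}
    (hW : ∀ i, ContDiff ℝ 1 (W i))
    (hb : ∀ x ∈ frontier Ω, ∑ i, W i x * n x i = 0) :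
    ∫ x in Ω, ∑ i, pd i (W i) x = 0 := by
  obtain ⟨R, hR0, hR⟩ := hdom.bounded.closure.subset_ball_lt 0 0
  let b : ContDiffBump (0 : Ed d) := ⟨R, R + 1, hR0, by linarith⟩
  have hb1 : ∀ x ∈ closure Ω, b =ᶠ[𝓝 x] 1 := fun x hx =>
    b.eventuallyEq_one_of_mem_ball (hR hx)
  rw [← hdom.setIntegral_div_eq_zero_of_hasCompactSupport (W := fun i x => b x * W i x)
    (fun i => b.contDiff.mul (hW i)) (fun i => b.hasCompactSupport.mul_right) (fun x hx => ?_)]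
  · refine setIntegral_congr_fun hdom.isOpen.measurableSet fun x hx => ?_
    refine Finset.sum_congr rfl fun i _ => ?_
    have : (fun x => b x * W i x) =ᶠ[𝓝 x] W i := by
      filter_upwards [hb1 x (subset_closure hx)] with y hy
      simp [hy]
    rw [pd, pd, this.fderiv_eq]
  · have h1 : b x = 1 := (hb1 x (frontier_subset_closure hx)).eq_of_nhds
    simpa [h1] using hb x hx

/-- A time-dependent scalar field that is jointly smooth in time and space. -/
def SmoothField {d : ℕ} (f : ℝ → Ed d → ℝ) : Prop :=
  ContDiff ℝ (⊤ : ℕ∞) fun p : ℝ × Ed d => f p.1 p.2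

lemma ContDiff.fderiv_fderiv_comm {E : Type*} [NormedAddCommGroup E] [NormedSpace ℝ E]
    {F : E → ℝ} (hF : ContDiff ℝ (⊤ : ℕ∞) F) (x v w : E) :
    fderiv ℝ (fun y => fderiv ℝ F y v) x w = fderiv ℝ (fun y => fderiv ℝ F y w) x v := by
  have hd : DifferentiableAt ℝ (fderiv ℝ F) x :=
    ((hF.fderiv_right (m := 1) (by norm_cast)).differentiable one_ne_zero) x
  have h : ∀ a, fderiv ℝ (fun y => fderiv ℝ F y a) x = (fderiv ℝ (fderiv ℝ F) x).flip a := by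
    intro a
    ext b
    rw [fderiv_clm_apply hd (differentiableAt_const a)]
    simp
  rw [h, h]
  exact (hF.contDiffAt.isSymmSndFDerivAt (by simp; norm_cast)) w v

namespace SmoothField

variable {d : ℕ} {f g : ℝ → Ed d → ℝ}

lemma contDiff_slice (hf : SmoothField f) (t : ℝ) : ContDiff ℝ (⊤ : ℕ∞) (f t) :=
  ContDiff.comp (g := fun p : ℝ × Ed d => f p.1 p.2) hf (contDiff_prodMk_right t)

lemma contDiff_one_slice (hf : SmoothField f) (t : ℝ) : ContDiff ℝ 1 (f t) :=
  (hf.contDiff_slice t).of_le (by norm_cast)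

lemma continuous_slice (hf : SmoothField f) (t : ℝ) : Continuous (f t) :=
  (hf.contDiff_slice t).continuous

lemma differentiable_slice (hf : SmoothField f) (t : ℝ) : Differentiable ℝ (f t) :=
  (hf.contDiff_slice t).differentiable (by simp)

lemma differentiable_uncurry (hf : SmoothField f) :
    Differentiable ℝ fun p : ℝ × Ed d => f p.1 p.2 :=
  ContDiff.differentiable hf (by simp)

lemma pd_eq_fderiv (hf : SmoothField f) (i : Fin d) (t : ℝ) (x : Ed d) :
    _root_.pd i (f t) x
      = fderiv ℝ (fun p : ℝ × Ed d => f p.1 p.2) (t, x) (0, EuclideanSpace.single i 1) := by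
  have h := (hf.differentiable_uncurry (t, x)).hasFDerivAt.comp x (hasFDerivAt_prodMk_right t x)
  have h' : fderiv ℝ (f t) x = _ := h.fderiv
  rw [_root_.pd, h']
  simp

lemma tder_eq_fderiv (hf : SmoothField f) (t : ℝ) (x : Ed d) :
    _root_.tder f t x = fderiv ℝ (fun p : ℝ × Ed d => f p.1 p.2) (t, x) (1, 0) := by
  have h := (hf.differentiable_uncurry (t, x)).hasFDerivAt.comp t
    (hasFDerivAt_prodMk_left (𝕜 := ℝ) t x)
  have h' : deriv (fun s => f s x) t = _ := h.hasDerivAt.deriv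
  rw [_root_.tder, h']
  simp

lemma hasDerivAt (hf : SmoothField f) (t : ℝ) (x : Ed d) :
    HasDerivAt (fun s => f s x) (_root_.tder f t x) t := by
  have h := (hf.differentiable_uncurry (t, x)).hasFDerivAt.comp t
    (hasFDerivAt_prodMk_left (𝕜 := ℝ) t x)
  exact h.differentiableAt.hasDerivAt

lemma fderiv_apply (hf : SmoothField f) (v : ℝ × Ed d) :
    SmoothField fun t x => fderiv ℝ (fun p : ℝ × Ed d => f p.1 p.2) (t, x) v :=
  (ContDiff.fderiv_right hf (m := (⊤ : ℕ∞)) (by norm_cast)).clm_apply contDiff_const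

lemma pd (hf : SmoothField f) (i : Fin d) : SmoothField fun t x => pd i (f t) x := by
  simp_rw [hf.pd_eq_fderiv]
  exact hf.fderiv_apply _

lemma tder (hf : SmoothField f) : SmoothField (tder f) := by
  have : _root_.tder f = fun t x => _root_.tder f t x := rfl
  rw [this]
  simp_rw [hf.tder_eq_fderiv]
  exact hf.fderiv_apply _

lemma pd_pd_comm (hf : SmoothField f) (i j : Fin d) (t : ℝ) (x : Ed d) :
    _root_.pd i (fun y => _root_.pd j (f t) y) x
      = _root_.pd j (fun y => _root_.pd i (f t) y) x := by
  rw [(hf.pd j).pd_eq_fderiv, (hf.pd i).pd_eq_fderiv]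
  simp_rw [hf.pd_eq_fderiv]
  exact ContDiff.fderiv_fderiv_comm hf _ _ _

lemma tder_pd_comm (hf : SmoothField f) (i : Fin d) (t : ℝ) (x : Ed d) :
    _root_.tder (fun s y => _root_.pd i (f s) y) t x = _root_.pd i (_root_.tder f t) x := by
  rw [(hf.pd i).tder_eq_fderiv, hf.tder.pd_eq_fderiv]
  simp_rw [hf.pd_eq_fderiv, hf.tder_eq_fderiv]
  exact ContDiff.fderiv_fderiv_comm hf _ _ _

lemma add (hf : SmoothField f) (hg : SmoothField g) : SmoothField fun t x => f t x + g t x :=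
  ContDiff.add hf hg

lemma sub (hf : SmoothField f) (hg : SmoothField g) : SmoothField fun t x => f t x - g t x :=
  ContDiff.sub hf hg

lemma mul (hf : SmoothField f) (hg : SmoothField g) : SmoothField fun t x => f t x * g t x :=
  ContDiff.mul hf hg

lemma const_mul (c : ℝ) (hf : SmoothField f) : SmoothField fun t x => c * f t x :=
  ContDiff.mul contDiff_const hf

lemma pow (hf : SmoothField f) (k : ℕ) : SmoothField fun t x => f t x ^ k :=
  ContDiff.pow hf k

lemma sum {ι : Type*} {s : Finset ι} {f : ι → ℝ → Ed d → ℝ} (hf : ∀ i ∈ s, SmoothField (f i)) :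
    SmoothField fun t x => ∑ i ∈ s, f i t x :=
  ContDiff.sum hf

lemma integrableOn (hf : SmoothField f) {Ω : Set (Ed d)} (hΩ : Bornology.IsBounded Ω) (t : ℝ) :
    IntegrableOn (f t) Ω :=
  ((hf.continuous_slice t).continuousOn.integrableOn_compact hΩ.isCompact_closure).mono_set
    subset_closure

/-- Differentiation under the integral sign over a bounded set. -/
lemma hasDerivAt_setIntegral (hf : SmoothField f) {Ω : Set (Ed d)} (hΩ : Bornology.IsBounded Ω)
    (hΩm : MeasurableSet Ω) (t : ℝ) :
    HasDerivAt (fun s => ∫ x in Ω, f s x) (∫ x in Ω, _root_.tder f t x) t := by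
  obtain ⟨C, hC⟩ := ((isCompact_Icc (a := t - 1) (b := t + 1)).prod
    hΩ.isCompact_closure).exists_bound_of_continuousOn
      (f := fun p : ℝ × Ed d => _root_.tder f p.1 p.2) (ContDiff.continuous hf.tder).continuousOn
  refine (hasDerivAt_integral_of_dominated_loc_of_deriv_le (μ := volume.restrict Ω)
    (F' := _root_.tder f) (bound := fun _ => C)
    (Icc_mem_nhds (show t - 1 < t by linarith) (show t < t + 1 by linarith))
    (Eventually.of_forall fun s => (hf.continuous_slice s).aestronglyMeasurable)
    (hf.integrableOn hΩ t) (hf.tder.continuous_slice t).aestronglyMeasurable ?_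
    (integrableOn_const hΩ.measure_lt_top.ne)
    (Eventually.of_forall fun x s _ => hf.hasDerivAt s x)).2
  filter_upwards [ae_restrict_mem hΩm] with x hx s hs
  exact hC (s, x) ⟨hs, subset_closure hx⟩

/-- An integral whose time derivative vanishes at positive times is conserved. -/
lemma setIntegral_eq_of_tder (hf : SmoothField f) {Ω : Set (Ed d)}
    (hΩ : Bornology.IsBounded Ω) (hΩm : MeasurableSet Ω)
    (h0 : ∀ t, 0 < t → ∫ x in Ω, _root_.tder f t x = 0) {t : ℝ} (ht : 0 ≤ t) :
    ∫ x in Ω, f t x = ∫ x in Ω, f 0 x := by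
  rcases ht.eq_or_lt with rfl | ht
  · rfl
  have hd := fun s => hf.hasDerivAt_setIntegral hΩ hΩm s
  obtain ⟨s, hs, hs'⟩ := exists_hasDerivAt_eq_slope (fun s => ∫ x in Ω, f s x) _ ht
    (fun s _ => (hd s).continuousAt.continuousWithinAt) (fun s _ => hd s)
  rw [h0 s hs.1, eq_comm, div_eq_zero_iff] at hs'
  rcases hs' with h | h <;> linarith

end SmoothField

lemma pd_congr_on {d : ℕ} {Ω : Set (Ed d)} (hΩ : IsOpen Ω) {f g : Ed d → ℝ}
    (h : ∀ y ∈ Ω, f y = g y) {x : Ed d} (hx : x ∈ Ω) (i : Fin d) : pd i f x = pd i g x := by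
  have : f =ᶠ[𝓝 x] g := by filter_upwards [hΩ.mem_nhds hx] with y hy using h y hy
  rw [pd, pd, this.fderiv_eq]

lemma pd_add {d : ℕ} {f g : Ed d → ℝ} (hf : Differentiable ℝ f) (hg : Differentiable ℝ g)
    (i : Fin d) (x : Ed d) : pd i (fun y => f y + g y) x = pd i f x + pd i g x := by
  simp [pd, fderiv_fun_add (hf x) (hg x)]

lemma pd_sub {d : ℕ} {f g : Ed d → ℝ} (hf : Differentiable ℝ f) (hg : Differentiable ℝ g)
    (i : Fin d) (x : Ed d) : pd i (fun y => f y - g y) x = pd i f x - pd i g x := by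
  simp [pd, fderiv_fun_sub (hf x) (hg x)]

lemma pd_mul {d : ℕ} {f g : Ed d → ℝ} (hf : Differentiable ℝ f) (hg : Differentiable ℝ g)
    (i : Fin d) (x : Ed d) :
    pd i (fun y => f y * g y) x = f x * pd i g x + pd i f x * g x := by
  simp [pd, fderiv_fun_mul (hf x) (hg x), mul_comm]

lemma pd_const_mul {d : ℕ} {f : Ed d → ℝ} (c : ℝ) (hf : Differentiable ℝ f)
    (i : Fin d) (x : Ed d) : pd i (fun y => c * f y) x = c * pd i f x := by
  simp [pd, fderiv_const_mul (hf x)]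

lemma pd_const {d : ℕ} (c : ℝ) (i : Fin d) (x : Ed d) : pd i (fun _ : Ed d => c) x = 0 := by
  simp [pd]

lemma pd_sum {d : ℕ} {ι : Type*} {s : Finset ι} {f : ι → Ed d → ℝ}
    (hf : ∀ j ∈ s, Differentiable ℝ (f j)) (i : Fin d) (x : Ed d) :
    pd i (fun y => ∑ j ∈ s, f j y) x = ∑ j ∈ s, pd i (f j) x := by
  simp [pd, fderiv_fun_sum fun j hj => hf j hj x]

lemma tder_congr {α F : Type*} [NormedAddCommGroup F] [NormedSpace ℝ F] {u v : ℝ → α → F} {x : α}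
    (h : ∀ s, 0 < s → u s x = v s x) {t : ℝ} (ht : 0 < t) : tder u t x = tder v t x := by
  refine Filter.EventuallyEq.deriv_eq ?_
  filter_upwards [lt_mem_nhds ht] with s hs using h s hs

lemma SmoothField.component {d : ℕ} {u : ℝ → Ed d → Ed d}
    (hu : ContDiff ℝ (⊤ : ℕ∞) fun p : ℝ × Ed d => u p.1 p.2) (j : Fin d) :
    SmoothField fun t x => u t x j :=
  (contDiff_piLp 2).1 hu j

lemma tder_apply {d : ℕ} {u : ℝ → Ed d → Ed d}
    (hu : ContDiff ℝ (⊤ : ℕ∞) fun p : ℝ × Ed d => u p.1 p.2) (t : ℝ) (x : Ed d) (j : Fin d) :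
    tder u t x j = tder (fun s y => u s y j) t x := by
  have hd : DifferentiableAt ℝ (fun s => u s x) t :=
    (hu.comp (contDiff_prodMk_left x)).differentiable (by simp) t
  exact ((EuclideanSpace.proj j : Ed d →L[ℝ] ℝ).hasFDerivAt.comp_hasDerivAt t
    hd.hasDerivAt).deriv.symm

lemma contDiff_tder {d : ℕ} {u : ℝ → Ed d → Ed d}
    (hu : ContDiff ℝ (⊤ : ℕ∞) fun p : ℝ × Ed d => u p.1 p.2) :
    ContDiff ℝ (⊤ : ℕ∞) fun p : ℝ × Ed d => tder u p.1 p.2 := by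
  refine (contDiff_piLp 2).2 fun j => ?_
  simp_rw [tder_apply hu]
  exact (SmoothField.component hu j).tder

section VectorFields

variable {d : ℕ} {u v : ℝ → Ed d → Ed d}

lemma SmoothField.curlM (hu : ContDiff ℝ (⊤ : ℕ∞) fun p : ℝ × Ed d => u p.1 p.2) (i j : Fin d) :
    SmoothField fun t x => curlM (u t) x i j :=
  ((SmoothField.component hu j).pd i).sub ((SmoothField.component hu i).pd j)

lemma SmoothField.divg (hu : ContDiff ℝ (⊤ : ℕ∞) fun p : ℝ × Ed d => u p.1 p.2) :
    SmoothField fun t x => divg (u t) x :=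
  SmoothField.sum fun i _ => (SmoothField.component hu i).pd i

lemma SmoothField.ccurl (hu : ContDiff ℝ (⊤ : ℕ∞) fun p : ℝ × Ed d => u p.1 p.2) (j : Fin d) :
    SmoothField fun t x => ccurl (u t) x j :=
  SmoothField.sum fun i _ => (SmoothField.curlM hu j i).pd i

lemma SmoothField.curlNormSq (hu : ContDiff ℝ (⊤ : ℕ∞) fun p : ℝ × Ed d => u p.1 p.2) :
    SmoothField fun t x => curlNormSq (u t) x :=
  (SmoothField.sum fun i _ => SmoothField.sum fun j _ => (SmoothField.curlM hu i j).pow 2).const_mul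
    (1 / 2)

lemma curlM_antisymm (w : Ed d → Ed d) (x : Ed d) (i j : Fin d) :
    curlM w x i j = -curlM w x j i := by
  simp [curlM]

lemma tder_pd_apply (hu : ContDiff ℝ (⊤ : ℕ∞) fun p : ℝ × Ed d => u p.1 p.2) (i j : Fin d)
    (t : ℝ) (x : Ed d) :
    tder (fun s y => pd i (fun z => u s z j) y) t x = pd i (fun z => tder u t z j) x := by
  rw [(SmoothField.component hu j).tder_pd_comm]
  simp_rw [tder_apply hu]

lemma tder_curlM (hu : ContDiff ℝ (⊤ : ℕ∞) fun p : ℝ × Ed d => u p.1 p.2) (i j : Fin d)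
    (t : ℝ) (x : Ed d) :
    tder (fun s y => curlM (u s) y i j) t x = curlM (tder u t) x i j := by
  rw [curlM, ← tder_pd_apply hu, ← tder_pd_apply hu]
  exact ((((SmoothField.component hu j).pd i).hasDerivAt t x).sub
    (((SmoothField.component hu i).pd j).hasDerivAt t x)).deriv

lemma tder_divg (hu : ContDiff ℝ (⊤ : ℕ∞) fun p : ℝ × Ed d => u p.1 p.2) (t : ℝ) (x : Ed d) :
    tder (fun s y => divg (u s) y) t x = divg (tder u t) x := by
  simp_rw [divg, ← tder_pd_apply hu]
  exact (HasDerivAt.fun_sum fun i _ => ((SmoothField.component hu i).pd i).hasDerivAt t x).deriv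

lemma ccurl_eq (hu : ContDiff ℝ (⊤ : ℕ∞) fun p : ℝ × Ed d => u p.1 p.2) (t : ℝ) (x : Ed d)
    (j : Fin d) : ccurl (u t) x j = pd j (divg (u t)) x - veclap (u t) x j := by
  have hs := fun i => SmoothField.component hu i
  have h : pd j (divg (u t)) x = ∑ i, pd j (fun y => pd i (fun z => u t z i) y) x :=
    pd_sum (fun i _ => ((hs i).pd i).differentiable_slice t) j x
  rw [h, ccurl, veclap, ← Finset.sum_sub_distrib]
  refine Finset.sum_congr rfl fun i _ => ?_
  rw [(hs i).pd_pd_comm j i]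
  exact pd_sub (((hs i).pd j).differentiable_slice t) (((hs j).pd i).differentiable_slice t) i x

lemma tder_eq_add (hu : ContDiff ℝ (⊤ : ℕ∞) fun p : ℝ × Ed d => u p.1 p.2)
    (hv : ContDiff ℝ (⊤ : ℕ∞) fun p : ℝ × Ed d => v p.1 p.2) {w : ℝ → Ed d → Ed d} {x : Ed d}
    (h : ∀ s, 0 < s → w s x = u s x + v s x) {t : ℝ} (ht : 0 < t) :
    tder w t x = tder u t x + tder v t x := by
  rw [tder_congr (v := fun s x => u s x + v s x) h ht]
  exact deriv_fun_add ((hu.comp (contDiff_prodMk_left x)).differentiable (by simp) t)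
    ((hv.comp (contDiff_prodMk_left x)).differentiable (by simp) t)

lemma sum_tder_mul_eq_zero (hu : ContDiff ℝ (⊤ : ℕ∞) fun p : ℝ × Ed d => u p.1 p.2)
    {x m : Ed d} (h : ∀ s, 0 < s → ∑ i, u s x i * m i = 0) {t : ℝ} (ht : 0 < t) :
    ∑ i, tder u t x i * m i = 0 := by
  simp_rw [tder_apply hu]
  have h1 : tder (fun s y => ∑ i, u s y i * m i) t x = 0 := by
    rw [tder_congr (v := fun _ _ => (0 : ℝ)) h ht]
    exact deriv_const t 0
  rw [← h1]
  exact (HasDerivAt.fun_sum fun i _ =>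
    ((SmoothField.component hu i).hasDerivAt t x).mul_const (m i)).deriv.symm

/-- Product rule for the divergence of `y ↦ ∑ j, (curl w)ⱼᵢ bⱼ`. -/
lemma sum_pd_sum_curlM_mul (hu : ContDiff ℝ (⊤ : ℕ∞) fun p : ℝ × Ed d => u p.1 p.2)
    {b : Fin d → Ed d → ℝ} (hb : ∀ j, Differentiable ℝ (b j)) (t : ℝ) (x : Ed d) :
    ∑ i, pd i (fun y => ∑ j, curlM (u t) y j i * b j y) x
      = ∑ j, ccurl (u t) x j * b j x + ∑ i, ∑ j, curlM (u t) x j i * pd i (b j) x := by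
  have h : ∀ i, pd i (fun y => ∑ j, curlM (u t) y j i * b j y) x
      = ∑ j, (curlM (u t) x j i * pd i (b j) x + pd i (fun y => curlM (u t) y j i) x * b j x) := by
    intro i
    have hC := fun j => (SmoothField.curlM hu j i).differentiable_slice t
    rw [pd_sum fun j _ => (hC j).fun_mul (hb j)]
    exact Finset.sum_congr rfl fun j _ => pd_mul (hC j) (hb j) i x
  simp_rw [h, Finset.sum_add_distrib, ccurl, Finset.sum_mul]
  rw [add_comm, Finset.sum_comm]

/-- The contraction of the antisymmetric curl with a matrix sees only the antisymmetric part. -/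
lemma sum_curlM_mul (w : Ed d → Ed d) (x : Ed d) (A : Fin d → Fin d → ℝ) :
    ∑ i, ∑ j, curlM w x j i * A i j = -(1 / 2) * ∑ i, ∑ j, curlM w x i j * (A i j - A j i) := by
  have h1 : ∑ i, ∑ j, curlM w x i j * A j i = ∑ i, ∑ j, curlM w x j i * A i j := Finset.sum_comm
  have h2 : ∑ i, ∑ j, curlM w x i j * A i j = -∑ i, ∑ j, curlM w x j i * A i j := by
    simp_rw [← Finset.sum_neg_distrib]
    refine Finset.sum_congr rfl fun i _ => Finset.sum_congr rfl fun j _ => ?_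
    rw [curlM_antisymm w x i j]; ring
  simp_rw [mul_sub, Finset.sum_sub_distrib, h1, h2]
  ring

end VectorFields

section Energy

variable {d : ℕ} {Ω : Set (Ed d)} {n : Ed d → Ed d}

/-- The divergence-free tangential vector fields of the form `γ_tt + μ curl curl γ` are orthogonal
to gradients, so such a field vanishes as soon as it is a gradient. -/
lemma GoodDomain.eq_zero_of_eq_grad (hdom : GoodDomain d Ω n) {μ : ℝ} {γ a : ℝ → Ed d → Ed d}
    {ψ : ℝ → Ed d → ℝ} (hγ : ContDiff ℝ (⊤ : ℕ∞) fun p : ℝ × Ed d => γ p.1 p.2)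
    (ha : ContDiff ℝ (⊤ : ℕ∞) fun p : ℝ × Ed d => a p.1 p.2) (hψ : SmoothField ψ) {t : ℝ}
    (hdiv : ∀ x ∈ Ω, divg (a t) x = 0) (hbc : ∀ x ∈ frontier Ω, ∑ i, a t x i * n x i = 0)
    (hbN : ∀ x ∈ frontier Ω, ∀ i, ∑ j, curlM (γ t) x i j * n x j = 0)
    (hgrad : ∀ x ∈ Ω, ∀ j, a t x j + μ * ccurl (γ t) x j = pd j (ψ t) x) :
    ∀ x ∈ Ω, ∀ j, a t x j + μ * ccurl (γ t) x j = 0 := by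
  have hsa := fun i => SmoothField.component ha i
  have hsC := fun i j => SmoothField.curlM hγ i j
  have hsum : ∀ i, SmoothField fun t x => ∑ j, curlM (γ t) x j i * pd j (ψ t) x := fun i =>
    SmoothField.sum fun j _ => (hsC j i).mul (hψ.pd j)
  have hw : ∀ j, SmoothField fun t x => a t x j + μ * ccurl (γ t) x j := fun j =>
    (hsa j).add ((SmoothField.ccurl hγ j).const_mul μ)
  have hsq : SmoothField fun t x => ∑ j, (a t x j + μ * ccurl (γ t) x j) ^ 2 :=
    SmoothField.sum fun j _ => (hw j).pow 2
  have hint : ∫ x in Ω, ∑ j, (a t x j + μ * ccurl (γ t) x j) ^ 2 = 0 := by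
    rw [← hdom.setIntegral_div_eq_zero
      (W := fun i x => ψ t x * a t x i + μ * ∑ j, curlM (γ t) x j i * pd j (ψ t) x)
      (fun i => ((hψ.mul (hsa i)).add ((hsum i).const_mul μ)).contDiff_one_slice t) ?_]
    · refine setIntegral_congr_fun hdom.isOpen.measurableSet fun x hx => ?_
      have h1 : ∀ i, pd i (fun x => ψ t x * a t x i
          + μ * ∑ j, curlM (γ t) x j i * pd j (ψ t) x) x
          = ψ t x * pd i (fun y => a t y i) x + pd i (ψ t) x * a t x i
            + μ * pd i (fun y => ∑ j, curlM (γ t) y j i * pd j (ψ t) y) x := by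
        intro i
        rw [pd_add ((hψ.mul (hsa i)).differentiable_slice t)
            (((hsum i).const_mul μ).differentiable_slice t),
          pd_mul (hψ.differentiable_slice t) ((hsa i).differentiable_slice t),
          pd_const_mul μ ((hsum i).differentiable_slice t)]
      have h2 : ∑ i, ψ t x * pd i (fun y => a t y i) x = 0 := by
        rw [← Finset.mul_sum]
        exact mul_eq_zero_of_right _ (hdiv x hx)
      have h3 : ∑ i, ∑ j, curlM (γ t) x j i * pd i (fun y => pd j (ψ t) y) x = 0 := by
        rw [sum_curlM_mul]
        have : ∀ i j, pd i (fun y => pd j (ψ t) y) x - pd j (fun y => pd i (ψ t) y) x = 0 :=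
          fun i j => sub_eq_zero.2 (hψ.pd_pd_comm i j t x)
        simp [this]
      simp only [h1]
      rw [Finset.sum_add_distrib, Finset.sum_add_distrib, h2, ← Finset.mul_sum,
        sum_pd_sum_curlM_mul hγ (fun j => (hψ.pd j).differentiable_slice t), h3, zero_add, add_zero,
        Finset.mul_sum, ← Finset.sum_add_distrib]
      refine Finset.sum_congr rfl fun j _ => ?_
      rw [← hgrad x hx j]
      ring
    · intro x hx
      simp_rw [add_mul, Finset.sum_add_distrib, mul_assoc, ← Finset.mul_sum, hbc x hx,
        Finset.sum_mul]
      rw [Finset.sum_comm]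
      have h4 : ∀ j, ∑ i, curlM (γ t) x j i * pd j (ψ t) x * n x i = 0 := by
        intro j
        have : ∑ i, curlM (γ t) x j i * pd j (ψ t) x * n x i
            = (∑ i, curlM (γ t) x j i * n x i) * pd j (ψ t) x := by
          rw [Finset.sum_mul]
          exact Finset.sum_congr rfl fun i _ => by ring
        rw [this, hbN x hx j, zero_mul]
      simp [h4]
  have hnn : ∀ x, 0 ≤ ∑ j, (a t x j + μ * ccurl (γ t) x j) ^ 2 := fun x =>
    Finset.sum_nonneg fun j _ => sq_nonneg _
  have hae := (setIntegral_eq_zero_iff_of_nonneg_ae (ae_of_all _ hnn)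
    (hsq.integrableOn hdom.bounded t)).1 hint
  have hz := Measure.eqOn_open_of_ae_eq hae hdom.isOpen
    (hsq.continuous_slice t).continuousOn continuousOn_const
  intro x hx j
  have := (Finset.sum_eq_zero_iff_of_nonneg fun j _ => sq_nonneg _).1 (hz hx) j (Finset.mem_univ j)
  exact pow_eq_zero_iff two_ne_zero |>.1 this

/-- Conservation of energy for the homogeneous wave system `γ_tt + μ curl curl γ = 0`. -/
lemma GoodDomain.wave_energy_eq (hdom : GoodDomain d Ω n) {μ : ℝ} {γ : ℝ → Ed d → Ed d}
    (hγ : ContDiff ℝ (⊤ : ℕ∞) fun p : ℝ × Ed d => γ p.1 p.2)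
    (hwave : ∀ t, 0 < t → ∀ x ∈ Ω, ∀ j, tder (tder γ) t x j + μ * ccurl (γ t) x j = 0)
    (hbN : ∀ t, 0 < t → ∀ x ∈ frontier Ω, ∀ i, ∑ j, curlM (γ t) x i j * n x j = 0)
    {t : ℝ} (ht : 0 ≤ t) :
    (1 / 2) * (∫ x in Ω, ∑ i, (tder γ t x i) ^ 2) + (μ / 2) * (∫ x in Ω, curlNormSq (γ t) x)
      = (1 / 2) * (∫ x in Ω, ∑ i, (tder γ 0 x i) ^ 2)
        + (μ / 2) * (∫ x in Ω, curlNormSq (γ 0) x) := by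
  have hγt := contDiff_tder hγ
  have hsv := fun i => SmoothField.component hγt i
  have hsC := fun i j => SmoothField.curlM hγ i j
  have hkin : SmoothField fun t x => (1 / 2) * ∑ i, (tder γ t x i) ^ 2 :=
    (SmoothField.sum fun i _ => (hsv i).pow 2).const_mul _
  have hpot : SmoothField fun t x => (μ / 2) * curlNormSq (γ t) x :=
    (SmoothField.curlNormSq hγ).const_mul _
  have hsplit : ∀ s, (1 / 2) * (∫ x in Ω, ∑ i, (tder γ s x i) ^ 2)
      + (μ / 2) * (∫ x in Ω, curlNormSq (γ s) x)
      = ∫ x in Ω, ((1 / 2) * ∑ i, (tder γ s x i) ^ 2 + (μ / 2) * curlNormSq (γ s) x) := by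
    intro s
    rw [integral_add (hkin.integrableOn hdom.bounded s) (hpot.integrableOn hdom.bounded s),
      integral_const_mul, integral_const_mul]
  rw [hsplit, hsplit]
  refine (hkin.add hpot).setIntegral_eq_of_tder hdom.bounded hdom.isOpen.measurableSet
    (fun s hs => ?_) ht
  have hW : ∀ i, SmoothField fun t x => ∑ j, curlM (γ t) x j i * tder γ t x j := fun i =>
    SmoothField.sum fun j _ => (hsC j i).mul (hsv j)
  have hdivW := hdom.setIntegral_div_eq_zero
    (W := fun i x => ∑ j, curlM (γ s) x j i * tder γ s x j)
    (fun i => (hW i).contDiff_one_slice s) (by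
      intro x hx
      simp_rw [Finset.sum_mul]
      rw [Finset.sum_comm]
      refine Finset.sum_eq_zero fun j _ => ?_
      have : ∑ i, curlM (γ s) x j i * tder γ s x j * n x i
          = (∑ i, curlM (γ s) x j i * n x i) * tder γ s x j := by
        rw [Finset.sum_mul]
        exact Finset.sum_congr rfl fun i _ => by ring
      rw [this, hbN s hs x hx j, zero_mul])
  rw [← mul_zero (-μ), ← hdivW, ← integral_const_mul]
  refine setIntegral_congr_fun hdom.isOpen.measurableSet fun x hx => ?_
  have hder : HasDerivAt
      (fun s => (1 / 2) * ∑ i, (tder γ s x i) ^ 2 + (μ / 2) * curlNormSq (γ s) x)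
      ((1 / 2) * ∑ i, 2 * tder γ s x i * tder (tder γ) s x i
        + (μ / 2) * ((1 / 2) * ∑ i, ∑ j, 2 * curlM (γ s) x i j * curlM (tder γ s) x i j)) s := by
    refine HasDerivAt.add (HasDerivAt.const_mul _ (HasDerivAt.fun_sum fun i _ => ?_))
      (HasDerivAt.const_mul _ (HasDerivAt.const_mul _
        (HasDerivAt.fun_sum fun i _ => HasDerivAt.fun_sum fun j _ => ?_)))
    · rw [tder_apply hγt]
      simpa using ((hsv i).hasDerivAt s x).fun_pow 2
    · rw [← tder_curlM hγ]
      simpa using ((hsC i j).hasDerivAt s x).fun_pow 2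
  have hder' := hder.deriv
  simp only [tder] at hder' ⊢
  rw [hder']
  change _ = -μ * ∑ i, pd i (fun y => ∑ j, curlM (γ s) y j i * tder γ s y j) x
  rw [sum_pd_sum_curlM_mul hγ (fun j => (hsv j).differentiable_slice s), sum_curlM_mul]
  have h1 : ∑ i, 2 * tder γ s x i * tder (tder γ) s x i
      = -(2 * μ) * ∑ j, ccurl (γ s) x j * tder γ s x j := by
    rw [Finset.mul_sum]
    refine Finset.sum_congr rfl fun i _ => ?_
    have := hwave s hs x hx i
    rw [eq_neg_of_add_eq_zero_left this]
    ring
  have h2 : ∑ i, ∑ j, 2 * curlM (γ s) x i j * curlM (tder γ s) x i j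
      = 2 * ∑ i, ∑ j, curlM (γ s) x i j
        * (pd i (fun y => tder γ s y j) x - pd j (fun y => tder γ s y i) x) := by
    simp_rw [Finset.mul_sum, mul_assoc]
    rfl
  have h3 := congrArg₂ (fun a b : ℝ => (1 / 2) * a + (μ / 2) * ((1 / 2) * b)) h1 h2
  refine Eq.trans h3 ?_
  ring

/-- Conservation of energy for the coupled potential system. -/
lemma GoodDomain.thermo_energy_eq (hdom : GoodDomain d Ω n) {c ν : ℝ} {χ : ℝ → Ed d → Ed d}
    {θ : ℝ → Ed d → ℝ} (hχ : ContDiff ℝ (⊤ : ℕ∞) fun p : ℝ × Ed d => χ p.1 p.2)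
    (hθ : SmoothField θ)
    (hwave : ∀ t, 0 < t → ∀ x ∈ Ω, ∀ j,
      tder (tder χ) t x j - c * pd j (divg (χ t)) x = -ν * pd j (θ t) x)
    (hheat : ∀ t, 0 < t → ∀ x ∈ Ω,
      tder θ t x - lap (θ t) x = -ν * θ t x * divg (tder χ t) x)
    (hbc : ∀ t, 0 < t → ∀ x ∈ frontier Ω, ∑ i, tder χ t x i * n x i = 0)
    (hbθ : ∀ t, 0 < t → ∀ x ∈ frontier Ω, ∑ i, pd i (θ t) x * n x i = 0)
    {t : ℝ} (ht : 0 ≤ t) :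
    (1 / 2) * (∫ x in Ω, ∑ i, (tder χ t x i) ^ 2) + (c / 2) * (∫ x in Ω, (divg (χ t) x) ^ 2)
        + (∫ x in Ω, θ t x)
      = (1 / 2) * (∫ x in Ω, ∑ i, (tder χ 0 x i) ^ 2) + (c / 2) * (∫ x in Ω, (divg (χ 0) x) ^ 2)
        + (∫ x in Ω, θ 0 x) := by
  have hχt := contDiff_tder hχ
  have hsv := fun i => SmoothField.component hχt i
  have hsD := SmoothField.divg hχ
  have hkin : SmoothField fun t x => (1 / 2) * ∑ i, (tder χ t x i) ^ 2 :=
    (SmoothField.sum fun i _ => (hsv i).pow 2).const_mul _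
  have hpot : SmoothField fun t x => (c / 2) * (divg (χ t) x) ^ 2 :=
    (hsD.pow 2).const_mul _
  have hsplit : ∀ s, (1 / 2) * (∫ x in Ω, ∑ i, (tder χ s x i) ^ 2)
      + (c / 2) * (∫ x in Ω, (divg (χ s) x) ^ 2) + (∫ x in Ω, θ s x)
      = ∫ x in Ω, ((1 / 2) * ∑ i, (tder χ s x i) ^ 2 + (c / 2) * (divg (χ s) x) ^ 2 + θ s x) := by
    intro s
    rw [integral_add ((hkin.add hpot).integrableOn hdom.bounded s)
        (hθ.integrableOn hdom.bounded s),
      integral_add (hkin.integrableOn hdom.bounded s) (hpot.integrableOn hdom.bounded s),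
      integral_const_mul, integral_const_mul]
  rw [hsplit, hsplit]
  refine ((hkin.add hpot).add hθ).setIntegral_eq_of_tder hdom.bounded hdom.isOpen.measurableSet
    (fun s hs => ?_) ht
  have hf : SmoothField fun t x => c * divg (χ t) x - ν * θ t x :=
    (hsD.const_mul c).sub (hθ.const_mul ν)
  rw [← hdom.setIntegral_div_eq_zero
    (W := fun i x => (c * divg (χ s) x - ν * θ s x) * tder χ s x i + pd i (θ s) x)
    (fun i => ((hf.mul (hsv i)).add (hθ.pd i)).contDiff_one_slice s) (by
      intro x hx
      simp_rw [add_mul, Finset.sum_add_distrib, mul_assoc, ← Finset.mul_sum, hbc s hs x hx,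
        hbθ s hs x hx, mul_zero, add_zero])]
  refine setIntegral_congr_fun hdom.isOpen.measurableSet fun x hx => ?_
  have hder : HasDerivAt
      (fun s => (1 / 2) * ∑ i, (tder χ s x i) ^ 2 + (c / 2) * (divg (χ s) x) ^ 2 + θ s x)
      ((1 / 2) * ∑ i, 2 * tder χ s x i * tder (tder χ) s x i
        + (c / 2) * (2 * divg (χ s) x * divg (tder χ s) x) + tder θ s x) s := by
    refine HasDerivAt.add (HasDerivAt.add
      (HasDerivAt.const_mul _ (HasDerivAt.fun_sum fun i _ => ?_))
      (HasDerivAt.const_mul _ ?_)) (hθ.hasDerivAt s x)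
    · rw [tder_apply hχt]
      simpa using ((hsv i).hasDerivAt s x).fun_pow 2
    · rw [← tder_divg hχ]
      simpa using (hsD.hasDerivAt s x).fun_pow 2
  have h1 : ∀ i, pd i
      (fun x => (c * divg (χ s) x - ν * θ s x) * tder χ s x i + pd i (θ s) x) x
      = (c * divg (χ s) x - ν * θ s x) * pd i (fun y => tder χ s y i) x
        + (c * pd i (divg (χ s)) x - ν * pd i (θ s) x) * tder χ s x i
        + pd i (fun y => pd i (θ s) y) x := by
    intro i
    rw [pd_add ((hf.mul (hsv i)).differentiable_slice s) ((hθ.pd i).differentiable_slice s),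
      pd_mul (hf.differentiable_slice s) ((hsv i).differentiable_slice s),
      pd_sub ((hsD.const_mul c).differentiable_slice s) ((hθ.const_mul ν).differentiable_slice s),
      pd_const_mul c (hsD.differentiable_slice s), pd_const_mul ν (hθ.differentiable_slice s)]
  have h2 : ∑ i, 2 * tder χ s x i * tder (tder χ) s x i
      = 2 * ∑ i, (c * pd i (divg (χ s)) x - ν * pd i (θ s) x) * tder χ s x i := by
    rw [Finset.mul_sum]
    refine Finset.sum_congr rfl fun i _ => ?_
    have : tder (tder χ) s x i = c * pd i (divg (χ s)) x - ν * pd i (θ s) x := by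
      linarith [hwave s hs x hx i]
    rw [this]
    ring
  refine hder.deriv.trans ?_
  simp only [h1]
  rw [Finset.sum_add_distrib, Finset.sum_add_distrib, ← Finset.mul_sum, h2]
  have h3 := hheat s hs x hx
  change _ = (c * divg (χ s) x - ν * θ s x) * divg (tder χ s) x + _ + lap (θ s) x
  linear_combination h3

end Energy

/-- Helmholtz decomposition of solutions: the divergence-free part
solves the homogeneous wave system, the potential part is coupled to the
temperature, and the energy decomposes. -/
theorem helmholtz_decomposition_of_solutions {d : ℕ} {Ω : Set (Ed d)}
    {n : Ed d → Ed d} {μ lam ν : ℝ} {u : ℝ → Ed d → Ed d} {θ : ℝ → Ed d → ℝ}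
    (hdom : GoodDomain d Ω n) (hμ : 0 < μ) (hlam : 0 < 2 * μ + (d : ℝ) * lam)
    (hsol : IsSolution Ω n μ lam ν u θ)
    (γ χ : ℝ → Ed d → Ed d) (φ : ℝ → Ed d → ℝ)
    (hγs : ContDiff ℝ (⊤ : ℕ∞) (fun p : ℝ × Ed d => γ p.1 p.2))
    (hχs : ContDiff ℝ (⊤ : ℕ∞) (fun p : ℝ × Ed d => χ p.1 p.2))
    (hφs : ContDiff ℝ (⊤ : ℕ∞) (fun p : ℝ × Ed d => φ p.1 p.2))
    (hdecomp : ∀ t : ℝ, 0 ≤ t → ∀ x ∈ closure Ω, u t x = γ t x + χ t x)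
    (hγdiv : ∀ t : ℝ, 0 ≤ t → ∀ x ∈ Ω, divg (γ t) x = 0)
    (hγbc : ∀ t : ℝ, 0 ≤ t → ∀ x ∈ frontier Ω, ∑ i, γ t x i * n x i = 0)
    (hχgrad : ∀ t : ℝ, 0 ≤ t → ∀ x ∈ Ω, ∀ j : Fin d, χ t x j = pd j (φ t) x) :
    -- (i) `γ` solves the homogeneous wave system with its boundary conditions
    ((∀ t : ℝ, 0 < t → ∀ x ∈ Ω, ∀ j : Fin d,
        tder (tder γ) t x j - μ * veclap (γ t) x j = 0)
      ∧ (∀ t : ℝ, 0 < t → ∀ x ∈ frontier Ω, ∑ i, γ t x i * n x i = 0)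
      ∧ (∀ t : ℝ, 0 < t → ∀ x ∈ frontier Ω, ∀ i : Fin d,
          ∑ j, curlM (γ t) x i j * n x j = 0))
    -- (ii) `(χ, θ)` solves the coupled system with its boundary conditions
    ∧ ((∀ t : ℝ, 0 < t → ∀ x ∈ Ω, ∀ j : Fin d,
        tder (tder χ) t x j - (2 * μ + lam) * veclap (χ t) x j = -ν * pd j (θ t) x)
      ∧ (∀ t : ℝ, 0 < t → ∀ x ∈ Ω,
          tder θ t x - lap (θ t) x = -ν * θ t x * divg (tder χ t) x)
      ∧ (∀ t : ℝ, 0 < t → ∀ x ∈ frontier Ω, ∑ i, χ t x i * n x i = 0)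
      ∧ (∀ t : ℝ, 0 < t → ∀ x ∈ frontier Ω, ∑ i, pd i (θ t) x * n x i = 0))
    -- (iii) decomposition of the energy
    ∧ ((∀ t : ℝ, 0 ≤ t →
        (1 / 2) * (∫ x in Ω, ∑ i, (tder γ t x i) ^ 2)
          + (μ / 2) * (∫ x in Ω, curlNormSq (γ t) x)
        = (1 / 2) * (∫ x in Ω, ∑ i, (tder γ 0 x i) ^ 2)
          + (μ / 2) * (∫ x in Ω, curlNormSq (γ 0) x))
      ∧ (∀ t : ℝ, 0 ≤ t →
        (1 / 2) * (∫ x in Ω, ∑ i, (tder χ t x i) ^ 2)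
          + ((2 * μ + lam) / 2) * (∫ x in Ω, (divg (χ t) x) ^ 2)
          + (∫ x in Ω, θ t x)
        = (1 / 2) * (∫ x in Ω, ∑ i, (tder χ 0 x i) ^ 2)
          + ((2 * μ + lam) / 2) * (∫ x in Ω, (divg (χ 0) x) ^ 2)
          + (∫ x in Ω, θ 0 x))) := by
  have hsol_u := hsol.smooth_u
  have hθ : SmoothField θ := hsol.smooth_θ
  have hφ : SmoothField φ := hφs
  have hΩ := hdom.isOpen
  have hγt := contDiff_tder hγs
  have hχt := contDiff_tder hχs
  have hcγ := fun j => SmoothField.component hγs j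
  have hcχ := fun j => SmoothField.component hχs j
  have hadd : ∀ t, 0 ≤ t → ∀ x ∈ Ω, ∀ j, u t x j = γ t x j + χ t x j := fun t ht x hx j => by
    rw [hdecomp t ht x (subset_closure hx)]; rfl
  have hpdu : ∀ t, 0 ≤ t → ∀ x ∈ Ω, ∀ i j, pd i (fun y => u t y j) x
      = pd i (fun y => γ t y j) x + pd i (fun y => χ t y j) x := fun t ht x hx i j => by
    rw [pd_congr_on hΩ (fun y hy => hadd t ht y hy j) hx]
    exact pd_add ((hcγ j).differentiable_slice t) ((hcχ j).differentiable_slice t) i x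
  have hcurlχ : ∀ t, 0 ≤ t → ∀ x ∈ Ω, ∀ i j, curlM (χ t) x i j = 0 := fun t ht x hx i j => by
    rw [curlM, pd_congr_on hΩ (fun y hy => hχgrad t ht y hy j) hx,
      pd_congr_on hΩ (fun y hy => hχgrad t ht y hy i) hx]
    exact sub_eq_zero.2 (hφ.pd_pd_comm i j t x)
  have hcurlu : ∀ t, 0 ≤ t → ∀ x ∈ Ω, ∀ i j, curlM (u t) x i j = curlM (γ t) x i j :=
    fun t ht x hx i j => by
      have h := hcurlχ t ht x hx i j
      rw [curlM] at h ⊢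
      rw [hpdu t ht x hx, hpdu t ht x hx, curlM]
      linarith
  have hdivu : ∀ t, 0 ≤ t → ∀ x ∈ Ω, divg (u t) x = divg (χ t) x := fun t ht x hx => by
    rw [divg, Finset.sum_congr rfl fun i _ => hpdu t ht x hx i i, Finset.sum_add_distrib]
    change divg (γ t) x + divg (χ t) x = _
    rw [hγdiv t ht x hx, zero_add]
  have hccu : ∀ t, 0 ≤ t → ∀ x ∈ Ω, ∀ j, ccurl (u t) x j = ccurl (γ t) x j :=
    fun t ht x hx j => Finset.sum_congr rfl fun i _ =>
      pd_congr_on hΩ (fun y hy => hcurlu t ht y hy j i) hx i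
  have hlapγ : ∀ t, 0 ≤ t → ∀ x ∈ Ω, ∀ j, veclap (γ t) x j = -ccurl (γ t) x j :=
    fun t ht x hx j => by
      rw [ccurl_eq hγs, pd_congr_on hΩ (hγdiv t ht) hx, pd_const]
      ring
  have hlapχ : ∀ t, 0 ≤ t → ∀ x ∈ Ω, ∀ j, veclap (χ t) x j = pd j (divg (χ t)) x :=
    fun t ht x hx j => by
      have h : ccurl (χ t) x j = 0 := Finset.sum_eq_zero fun i _ => by
        rw [pd_congr_on hΩ (fun y hy => hcurlχ t ht y hy j i) hx, pd_const]
      rw [ccurl_eq hχs] at h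
      linarith
  have htu : ∀ t, 0 < t → ∀ x ∈ closure Ω, tder u t x = tder γ t x + tder χ t x :=
    fun t ht x hx => tder_eq_add hγs hχs (fun s hs => hdecomp s hs.le x hx) ht
  have httu : ∀ t, 0 < t → ∀ x ∈ closure Ω,
      tder (tder u) t x = tder (tder γ) t x + tder (tder χ) t x :=
    fun t ht x hx => tder_eq_add hγt hχt (fun s hs => htu s hs x hx) ht
  have hdivγt : ∀ t, 0 < t → ∀ x ∈ Ω, divg (tder γ t) x = 0 := fun t ht x hx => by
    rw [← tder_divg hγs, tder_congr (v := fun _ _ => (0 : ℝ)) (fun s hs => hγdiv s hs.le x hx) ht]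
    exact deriv_const t 0
  have hdivγtt : ∀ t, 0 < t → ∀ x ∈ Ω, divg (tder (tder γ) t) x = 0 := fun t ht x hx => by
    rw [← tder_divg hγt, tder_congr (v := fun _ _ => (0 : ℝ)) (fun s hs => hdivγt s hs x hx) ht]
    exact deriv_const t 0
  have hdivut : ∀ t, 0 < t → ∀ x ∈ Ω, divg (tder u t) x = divg (tder χ t) x :=
    fun t ht x hx => by
      rw [← tder_divg hsol_u, ← tder_divg hχs]
      exact tder_congr (fun s hs => hdivu s hs.le x hx) ht
  have hbcχ : ∀ t, 0 < t → ∀ x ∈ frontier Ω, ∑ i, χ t x i * n x i = 0 := fun t ht x hx => by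
    have h := hsol.bc_u t ht x hx
    rw [hdecomp t ht.le x (frontier_subset_closure hx)] at h
    simp_rw [PiLp.add_apply, add_mul, Finset.sum_add_distrib, hγbc t ht.le x hx, zero_add] at h
    exact h
  have hbN : ∀ t, 0 < t → ∀ x ∈ frontier Ω, ∀ i, ∑ j, curlM (γ t) x i j * n x j = 0 :=
    fun t ht x hx i => by
      rw [← hsol.bc_N t ht x hx i]
      refine Finset.sum_congr rfl fun j _ => ?_
      have h : EqOn (fun y => curlM (u t) y i j) (fun y => curlM (γ t) y i j) Ω :=
        fun y hy => hcurlu t ht.le y hy i j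
      exact congrArg (· * n x j) (h.closure ((SmoothField.curlM hsol_u i j).continuous_slice t)
        ((SmoothField.curlM hγs i j).continuous_slice t) (frontier_subset_closure hx)).symm
  have hψ : SmoothField fun t x =>
      (2 * μ + lam) * divg (χ t) x - ν * θ t x - tder (tder φ) t x :=
    (((SmoothField.divg hχs).const_mul _).sub (hθ.const_mul ν)).sub hφ.tder.tder
  have hχtt : ∀ t, 0 < t → ∀ x ∈ Ω, ∀ j,
      tder (tder χ) t x j = pd j (tder (tder φ) t) x := fun t ht x hx j => by
    rw [tder_apply hχt, ← hφ.tder.tder_pd_comm]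
    refine tder_congr (fun s hs => ?_) ht
    rw [tder_apply hχs, ← hφ.tder_pd_comm]
    exact tder_congr (fun r hr => hχgrad r hr.le x hx j) hs
  have hwave : ∀ t, 0 < t → ∀ x ∈ Ω, ∀ j,
      tder (tder γ) t x j + tder (tder χ) t x j - (2 * μ + lam) * pd j (divg (χ t)) x
        + μ * ccurl (γ t) x j = -ν * pd j (θ t) x := fun t ht x hx j => by
    have h := hsol.wave t ht x hx j
    rw [httu t ht x (subset_closure hx), hccu t ht.le x hx, pd_congr_on hΩ (hdivu t ht.le) hx,
      PiLp.add_apply] at h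
    exact h
  have hγwave : ∀ t, 0 < t → ∀ x ∈ Ω, ∀ j,
      tder (tder γ) t x j + μ * ccurl (γ t) x j = 0 := fun t ht => by
    refine hdom.eq_zero_of_eq_grad hγs (contDiff_tder hγt) hψ (hdivγtt t ht)
      (fun x hx => ?_) (hbN t ht) (fun x hx j => ?_)
    · exact sum_tder_mul_eq_zero hγt
        (fun s hs => sum_tder_mul_eq_zero hγs (fun r hr => hγbc r hr.le x hx) hs) ht
    · rw [pd_sub ((((SmoothField.divg hχs).const_mul _).sub (hθ.const_mul ν)).differentiable_slice t)
          (hφ.tder.tder.differentiable_slice t),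
        pd_sub (((SmoothField.divg hχs).const_mul _).differentiable_slice t)
          ((hθ.const_mul ν).differentiable_slice t),
        pd_const_mul _ ((SmoothField.divg hχs).differentiable_slice t),
        pd_const_mul _ (hθ.differentiable_slice t)]
      linarith [hwave t ht x hx j, hχtt t ht x hx j]
  have hχwave : ∀ t, 0 < t → ∀ x ∈ Ω, ∀ j,
      tder (tder χ) t x j - (2 * μ + lam) * pd j (divg (χ t)) x = -ν * pd j (θ t) x :=
    fun t ht x hx j => by linarith [hwave t ht x hx j, hγwave t ht x hx j]
  have hheat : ∀ t, 0 < t → ∀ x ∈ Ω,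
      tder θ t x - lap (θ t) x = -ν * θ t x * divg (tder χ t) x := fun t ht x hx => by
    rw [hsol.heat t ht x hx, hdivut t ht x hx]
  refine ⟨⟨fun t ht x hx j => ?_, fun t ht => hγbc t ht.le, hbN⟩,
    ⟨fun t ht x hx j => ?_, hheat, hbcχ, hsol.bc_θ⟩,
    fun t ht => hdom.wave_energy_eq hγs hγwave hbN ht,
    fun t ht => hdom.thermo_energy_eq hχs hθ hχwave hheat
      (fun s hs x hx => sum_tder_mul_eq_zero hχs (fun r hr => hbcχ r hr x hx) hs) hsol.bc_θ ht⟩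
  · rw [hlapγ t ht.le x hx]
    linarith [hγwave t ht x hx j]
  · rw [hlapχ t ht.le x hx]
    exact hχwave t ht x hx j
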